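/- Racy path normal form: Let u0 be a node of the race-detecting state graph G of a barrier-free program with finitely many reachable nodes. If G has a path from u0 whose execution contains a data race, then there is a finite complete path β from u0 with blocks B_1,…,B_N and some i ∈ [1, N−1] such that B_i races with B_N (some event of B_i races with some event of B_N in the execution of β) and no block B_j with j ∈ [i+1, N] has tid(B_j) = tid(B_i). -/

import Mathlib

namespace MC

/-- Statements of a thread: acquire/release a lock, barrier exit, or an nsync statement. -/
inductive Stmt (Lock NStmt : Type) where
  | acquire : Lock → Stmt Lock NStmt
  | release : Lock → Stmt Lock NStmt
  | exit : Stmt Lock NStmt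
  | nsync : NStmt → Stmt Lock NStmt

/-- The kind of a local state: acquire state (with its lock), release state,
barrier state, nsync state, or terminal state. -/
inductive LKind (Lock : Type) where
  | acquire : Lock → LKind Lock
  | release : Lock → LKind Lock
  | barrier : LKind Lock
  | nsync : LKind Lock
  | term : LKind Lock

def LKind.isBarrier {L : Type} : LKind L → Bool
  | .barrier => true
  | _ => false

def LKind.isTerm {L : Type} : LKind L → Bool
  | .term => true
  | _ => false

/-- A multithreaded program with thread ID set `Fin n`. -/
structure Program where
  n : ℕ
  npos : 0 < n
  Lock : Type
  Shared : Type
  Local : Fin n → Type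
  NStmt : Fin n → Type
  kind : ∀ i, Local i → LKind Lock
  next : ∀ i, Local i → Local i
  stmts : ∀ i, Local i → Set (NStmt i)
  stmtsNonempty : ∀ i σ, kind i σ = .nsync → (stmts i σ).Nonempty
  update : ∀ i, Local i → NStmt i → Shared → Local i × Shared

variable {P : Program}

/-- Global statements: a thread ID together with one of its statements. -/
abbrev GStmt (P : Program) := Σ i : Fin P.n, Stmt P.Lock (P.NStmt i)

def GStmt.isNsync (t : GStmt P) : Prop := ∃ m, t.2 = Stmt.nsync m
def GStmt.isExit (t : GStmt P) : Prop := t.2 = Stmt.exit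
def GStmt.isExitZero (t : GStmt P) : Prop := t.2 = Stmt.exit ∧ (t.1 : ℕ) = 0
def GStmt.isReleaseOn (t : GStmt P) (l : P.Lock) : Prop := t.2 = Stmt.release l
def GStmt.isAcquireOn (t : GStmt P) (l : P.Lock) : Prop := t.2 = Stmt.acquire l

/-- A global state: local state of each thread, shared state, lock state
(`none` = free), and barrier wait set. -/
structure GState (P : Program) where
  loc : ∀ i, P.Local i
  sh : P.Shared
  lk : P.Lock → Option (Fin P.n)
  wait : Set (Fin P.n)

/-- Enabledness of a statement at a global state. -/
def Enabled (s : GState P) : GStmt P → Prop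
  | ⟨i, st⟩ =>
    match P.kind i (s.loc i), st with
    | .acquire l, .acquire l' => l = l' ∧ s.lk l = none
    | .release l, .release l' => l = l' ∧ s.lk l = some i
    | .barrier, .exit => i ∉ s.wait
    | .nsync, .nsync m => m ∈ P.stmts i (s.loc i)
    | _, _ => False

open Classical in
/-- Execution of a statement at a global state. -/
noncomputable def execute (s : GState P) : GStmt P → GState P
  | ⟨i, st⟩ =>
    let r : P.Local i × P.Shared × (P.Lock → Option (Fin P.n)) :=
      match st with
      | .acquire l => (P.next i (s.loc i), s.sh, fun l' => if l' = l then some i else s.lk l')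
      | .release l => (P.next i (s.loc i), s.sh, fun l' => if l' = l then none else s.lk l')
      | .exit => (P.next i (s.loc i), s.sh, s.lk)
      | .nsync m => ((P.update i (s.loc i) m s.sh).1, (P.update i (s.loc i) m s.sh).2, s.lk)
    { loc := Function.update s.loc i r.1
      sh := r.2.1
      lk := r.2.2
      wait :=
        if (P.kind i r.1).isBarrier then
          (if s.wait ∪ {i} = Set.univ then (∅ : Set (Fin P.n)) else s.wait ∪ {i})
        else s.wait }

/-- Finite executions: `Exec s ts sf` means the statement sequence `ts` is
step-by-step enabled starting from `s` and leads to `sf`. -/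
inductive Exec : GState P → List (GStmt P) → GState P → Prop
  | nil (s : GState P) : Exec s [] s
  | cons {s s' sf : GState P} {t : GStmt P} {l : List (GStmt P)} :
      Enabled s t → execute s t = s' → Exec s' l sf → Exec s (t :: l) sf

/-- The program has no barrier local states. -/
def NoBarriers (P : Program) : Prop := ∀ i σ, P.kind i σ ≠ LKind.barrier

/-! ### Traces, events, happens-before, data races -/

/-- The thread ID of the event at position `k` of a trace (if any). -/
def tidAt (ts : List (GStmt P)) (k : ℕ) : Option (Fin P.n) := (ts[k]?).map (·.1)

/-- The statement at position `k` satisfies `p`. -/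
def stmtIs (ts : List (GStmt P)) (k : ℕ) (p : GStmt P → Prop) : Prop :=
  ∃ t, ts[k]? = some t ∧ p t

/-- Intra-thread order on trace positions. -/
def IntraThread (ts : List (GStmt P)) (j k : ℕ) : Prop :=
  j < k ∧ k < ts.length ∧ tidAt ts j = tidAt ts k

/-- Release-acquire relation on trace positions: a release of `l` is related to
the next subsequent acquire of `l`. -/
def RelAcq (ts : List (GStmt P)) (j k : ℕ) : Prop :=
  ∃ l : P.Lock, j < k ∧ stmtIs ts j (·.isReleaseOn l) ∧ stmtIs ts k (·.isAcquireOn l) ∧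
    ∀ m, j < m → m < k → ¬ stmtIs ts m (·.isAcquireOn l)

/-- The barrier epoch of the event at position `k`: the number of barrier-exit
events of the same thread at positions `≤ k`. -/
noncomputable def epoch (ts : List (GStmt P)) (k : ℕ) : ℕ :=
  Set.ncard {m : ℕ | m ≤ k ∧ tidAt ts m = tidAt ts k ∧ stmtIs ts m (·.isExit)}

/-- Barrier relation on trace positions: earlier epochs happen before later ones. -/
def BarrierRel (ts : List (GStmt P)) (j k : ℕ) : Prop :=
  j < ts.length ∧ k < ts.length ∧ epoch ts j < epoch ts k

/-- The happens-before relation on trace positions. -/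
def HB (ts : List (GStmt P)) : ℕ → ℕ → Prop :=
  Relation.TransGen (fun j k => IntraThread ts j k ∨ RelAcq ts j k ∨ BarrierRel ts j k)

/-- `C` is a conflict relation for `P`: symmetric, relating only nsync statements
from different threads, and non-conflicting nsync statements from different
threads commute whenever both are enabled. -/
structure IsConflictRel (P : Program) (C : GStmt P → GStmt P → Prop) : Prop where
  symm : ∀ t1 t2, C t1 t2 → C t2 t1
  nsync_left : ∀ t1 t2, C t1 t2 → t1.isNsync
  nsync_right : ∀ t1 t2, C t1 t2 → t2.isNsync
  diff : ∀ t1 t2, C t1 t2 → t1.1 ≠ t2.1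
  commute : ∀ t1 t2, t1.isNsync → t2.isNsync → t1.1 ≠ t2.1 → ¬ C t1 t2 →
    ∀ s : GState P, Enabled s t1 → Enabled s t2 →
      execute (execute s t1) t2 = execute (execute s t2) t1

/-- The events at positions `j` and `k` race: their statements conflict and the
positions are unordered by happens-before. -/
def Races (C : GStmt P → GStmt P → Prop) (ts : List (GStmt P)) (j k : ℕ) : Prop :=
  (∃ t1 t2, ts[j]? = some t1 ∧ ts[k]? = some t2 ∧ C t1 t2) ∧ ¬ HB ts j k ∧ ¬ HB ts k j

/-- The trace contains a data race. -/
def HasRace (C : GStmt P → GStmt P → Prop) (ts : List (GStmt P)) : Prop :=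
  ∃ j k, Races C ts j k

/-- The event (statement with per-thread occurrence number) at position `k`. -/
def eventAt (ts : List (GStmt P)) (k : ℕ) : Option (GStmt P × ℕ) :=
  (ts[k]?).map (fun t => (t, (ts.take (k+1)).countP (fun t' => decide (t'.1 = t.1))))

/-- The set of events of a trace. -/
def events (ts : List (GStmt P)) : Set (GStmt P × ℕ) :=
  {e | ∃ k, eventAt ts k = some e}

/-! ### The race-detecting state graph -/

/-- The edge relation of the local graph of thread `i`. -/
def isLocalStep (i : Fin P.n) (σ σ' : P.Local i) : Prop :=
  match P.kind i σ with
  | .nsync => ∃ m ζ, m ∈ P.stmts i σ ∧ (P.update i σ m ζ).1 = σ'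
  | .term => False
  | _ => σ' = P.next i σ

/-- Choice of sets `R i` containing all acquire and release local states and
meeting every cycle of the local graph of thread `i`. -/
structure RSets (P : Program) where
  R : ∀ i, Set (P.Local i)
  acq_mem : ∀ i σ l, P.kind i σ = LKind.acquire l → σ ∈ R i
  rel_mem : ∀ i σ l, P.kind i σ = LKind.release l → σ ∈ R i
  acyclic : ∀ i σ, σ ∉ R i →
    ¬ Relation.TransGen (fun a b => a ∉ R i ∧ b ∉ R i ∧ isLocalStep i a b) σ σ

/-- Thread `i` is normal at state `s`: its local state is not in `R i` and it
has an enabled statement. -/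
def Normal (RS : RSets P) (s : GState P) (i : Fin P.n) : Prop :=
  s.loc i ∉ RS.R i ∧ ∃ st : Stmt P.Lock (P.NStmt i), Enabled s ⟨i, st⟩

/-- A node of the race-detecting state graph: a state together with, for each
thread, the set of nsync statements recorded since its last synchronization. -/
structure RNode (P : Program) where
  st : GState P
  hist : ∀ i, Set (P.NStmt i)

/-- Edge relation of the race-detecting state graph. -/
def REdge (RS : RSets P) (u : RNode P) (t : GStmt P) (v : RNode P) : Prop :=
  Enabled u.st t ∧ v.st = execute u.st t ∧
  (∀ m, t.2 = Stmt.nsync m → v.hist t.1 = insert m (u.hist t.1)) ∧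
  (¬ t.isNsync →
    ((t.isExitZero ∨ u.st.loc t.1 ∈ RS.R t.1) → v.hist t.1 = ∅) ∧
    (¬ (t.isExitZero ∨ u.st.loc t.1 ∈ RS.R t.1) → v.hist t.1 = u.hist t.1)) ∧
  (∀ i, i ≠ t.1 →
    (t.isExitZero → v.hist i = ∅) ∧ (¬ t.isExitZero → v.hist i = u.hist i)) ∧
  ((∃ i, Normal RS u.st i) → Normal RS u.st t.1 ∧ ∀ j, Normal RS u.st j → t.1 ≤ j)

/-- Paths in the race-detecting state graph. -/
inductive RPath (RS : RSets P) : RNode P → List (GStmt P) → RNode P → Prop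
  | nil (u : RNode P) : RPath RS u [] u
  | cons {u v w : RNode P} {t : GStmt P} {l : List (GStmt P)} :
      REdge RS u t v → RPath RS v l w → RPath RS u (t :: l) w

/-- Reachability in the race-detecting state graph. -/
def RReach (RS : RSets P) (u v : RNode P) : Prop := ∃ l, RPath RS u l v

/-- Thread `i` detects a race at node `u`. -/
def ThreadDetects (C : GStmt P → GStmt P → Prop) (u : RNode P) (i : Fin P.n) : Prop :=
  ∃ j, j ≠ i ∧ ∃ m1 ∈ u.hist i, ∃ m2 ∈ u.hist j,
    C ⟨i, Stmt.nsync m1⟩ ⟨j, Stmt.nsync m2⟩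

/-- The edge `(u,t,v)` detects a race: the moving thread arrives at an `R i`,
barrier, or terminal local state and detects a race at the target node. -/
def EdgeDetects (RS : RSets P) (C : GStmt P → GStmt P → Prop)
    (u : RNode P) (t : GStmt P) (v : RNode P) : Prop :=
  REdge RS u t v ∧
  (v.st.loc t.1 ∈ RS.R t.1 ∨ (P.kind t.1 (v.st.loc t.1)).isBarrier = true ∨
    (P.kind t.1 (v.st.loc t.1)).isTerm = true) ∧
  ThreadDetects C v t.1

/-- The race-detecting state graph detects a race from `u0`. -/
def DetectsFrom (RS : RSets P) (C : GStmt P → GStmt P → Prop) (u0 : RNode P) : Prop :=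
  ∃ u t v, RReach RS u0 u ∧ EdgeDetects RS C u t v

/-- The initial node for state `s0`: all recorded sets empty. -/
def initNode (s0 : GState P) : RNode P := ⟨s0, fun _ => ∅⟩

/-! ### Abstract state graphs and density -/

/-- A state graph of `P`. -/
structure StateGraph (P : Program) where
  V : Type
  edge : V → GStmt P → V → Prop
  stateOf : V → GState P
  edge_enabled : ∀ {u t v}, edge u t v → Enabled (stateOf u) t
  edge_exec : ∀ {u t v}, edge u t v → stateOf v = execute (stateOf u) t
  edge_det : ∀ {u t v v'}, edge u t v → edge u t v' → v = v'

/-- The ample set of a node: the labels of its outgoing edges. -/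
def StateGraph.ample (G : StateGraph P) (u : G.V) : Set (GStmt P) :=
  {t | ∃ v, G.edge u t v}

/-- Paths in a state graph. -/
inductive GPath (G : StateGraph P) : G.V → List (GStmt P) → G.V → Prop
  | nil (u : G.V) : GPath G u [] u
  | cons {u v w : G.V} {t : GStmt P} {l : List (GStmt P)} :
      G.edge u t v → GPath G v l w → GPath G u (t :: l) w

/-- Density of a state graph (the four ample-set conditions). -/
def StateGraph.IsDense (G : StateGraph P) : Prop :=
  (∀ u, (∃ t, Enabled (G.stateOf u) t) → (G.ample u).Nonempty) ∧
  (∀ u t t', t ∈ G.ample u → Enabled (G.stateOf u) t' → t'.1 = t.1 → t' ∈ G.ample u) ∧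
  (∀ u, G.ample u ≠ {t | Enabled (G.stateOf u) t} → ∀ t ∈ G.ample u, t.isNsync) ∧
  (∀ u l, l ≠ [] → GPath G u l u →
    ∃ v l1 l2, l = l1 ++ l2 ∧ GPath G u l1 v ∧
      G.ample v = {t | Enabled (G.stateOf v) t})

/-! ### Paths as functions and block decompositions -/

/-- A path in the race-detecting state graph presented as a node function `f`
along a statement list `ts`. -/
def IsPathFn (RS : RSets P) (f : ℕ → RNode P) (ts : List (GStmt P)) : Prop :=
  ∀ k (h : k < ts.length), REdge RS (f k) (ts.get ⟨k, h⟩) (f (k+1))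

/-- The statement at position `m` continues the block started at position `b`:
it is from the same thread and that thread is normal at the node it executes from. -/
def SameBlockStep (RS : RSets P) (f : ℕ → RNode P) (ts : List (GStmt P)) (b m : ℕ) : Prop :=
  tidAt ts m = tidAt ts b ∧ ∃ t, ts[m]? = some t ∧ Normal RS (f m).st t.1

/-- `c 0 = 0 < c 1 < ⋯ < c N = |ts|` is the block decomposition of the path
`(f, ts)`: block `j` covers positions `[c j, c (j+1))`. -/
structure IsBlockDecomp (RS : RSets P) (f : ℕ → RNode P) (ts : List (GStmt P))
    (N : ℕ) (c : ℕ → ℕ) : Prop where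
  zero : c 0 = 0
  last : c N = ts.length
  mono : ∀ j, j < N → c j < c (j+1)
  inside : ∀ j, j < N → ∀ m, c j < m → m < c (j+1) → SameBlockStep RS f ts (c j) m
  boundary : ∀ j, j < N → c (j+1) < ts.length → ¬ SameBlockStep RS f ts (c j) (c (j+1))

/-- Block `j` is initial: its thread is normal at its starting node. -/
def BlockInitial (RS : RSets P) (f : ℕ → RNode P) (ts : List (GStmt P))
    (c : ℕ → ℕ) (j : ℕ) : Prop :=
  ∃ t, ts[c j]? = some t ∧ Normal RS (f (c j)).st t.1

/-- Block `j` is complete: its thread is not normal at its final node. -/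
def BlockComplete (RS : RSets P) (f : ℕ → RNode P) (ts : List (GStmt P))
    (c : ℕ → ℕ) (j : ℕ) : Prop :=
  ∀ t, ts[c j]? = some t → ¬ Normal RS (f (c (j+1))).st t.1

/-- The position permutation induced by transposing the adjacent segments
`[a,b)` and `[b,d)`. -/
def segSwap (a b d m : ℕ) : ℕ :=
  if m < a then m else if m < b then m + (d - b) else if m < d then m - (b - a) else m

/-- The position permutation induced by transposing positions `p` and `p+1`. -/
def posSwap (p m : ℕ) : ℕ :=
  if m = p then p + 1 else if m = p + 1 then p else m

/-! ### Proof -/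

theorem enabled_acq (s : GState P) (i : Fin P.n) (l : P.Lock) :
    Enabled s ⟨i, .acquire l⟩ ↔ P.kind i (s.loc i) = .acquire l ∧ s.lk l = none := by
  simp only [Enabled]
  cases h : P.kind i (s.loc i) <;> simp
  intro h1; subst h1; rfl

theorem enabled_rel (s : GState P) (i : Fin P.n) (l : P.Lock) :
    Enabled s ⟨i, .release l⟩ ↔ P.kind i (s.loc i) = .release l ∧ s.lk l = some i := by
  simp only [Enabled]
  cases h : P.kind i (s.loc i) <;> simp
  intro h1; subst h1; rfl

theorem enabled_nsync (s : GState P) (i : Fin P.n) (m : P.NStmt i) :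
    Enabled s ⟨i, .nsync m⟩ ↔ P.kind i (s.loc i) = .nsync ∧ m ∈ P.stmts i (s.loc i) := by
  simp only [Enabled]
  cases h : P.kind i (s.loc i) <;> simp

theorem enabled_exit (hnb : NoBarriers P) (s : GState P) (i : Fin P.n) :
    ¬ Enabled s ⟨i, .exit⟩ := by
  have := hnb i (s.loc i)
  simp only [Enabled]
  cases h : P.kind i (s.loc i) <;> simp
  exact absurd h this

theorem nbar (hnb : NoBarriers P) (i : Fin P.n) (x : P.Local i) :
    (P.kind i x).isBarrier = false := by
  have := hnb i x
  cases h : P.kind i x <;> simp_all [LKind.isBarrier]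

open Classical in
theorem exec_acq (hnb : NoBarriers P) (s : GState P) (i : Fin P.n) (l : P.Lock) :
    execute s ⟨i, .acquire l⟩ = ⟨Function.update s.loc i (P.next i (s.loc i)), s.sh,
      fun l' => if l' = l then some i else s.lk l', s.wait⟩ := by
  simp [execute, nbar hnb]

open Classical in
theorem exec_rel (hnb : NoBarriers P) (s : GState P) (i : Fin P.n) (l : P.Lock) :
    execute s ⟨i, .release l⟩ = ⟨Function.update s.loc i (P.next i (s.loc i)), s.sh,
      fun l' => if l' = l then none else s.lk l', s.wait⟩ := by
  simp [execute, nbar hnb]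

theorem exec_nsync (hnb : NoBarriers P) (s : GState P) (i : Fin P.n) (m : P.NStmt i) :
    execute s ⟨i, .nsync m⟩ = ⟨Function.update s.loc i (P.update i (s.loc i) m s.sh).1,
      (P.update i (s.loc i) m s.sh).2, s.lk, s.wait⟩ := by
  simp [execute, nbar hnb]

theorem exec_loc_ne (s : GState P) (t : GStmt P) (i : Fin P.n) (h : i ≠ t.1) :
    (execute s t).loc i = s.loc i := by
  obtain ⟨j, st⟩ := t
  simp only [execute]
  exact Function.update_of_ne h _ _

theorem normal_iff (hnb : NoBarriers P) (RS : RSets P) (s : GState P) (i : Fin P.n) :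
    Normal RS s i ↔ s.loc i ∉ RS.R i ∧ P.kind i (s.loc i) = .nsync := by
  unfold Normal
  constructor
  · rintro ⟨h, st, he⟩
    refine ⟨h, ?_⟩
    cases st with
    | acquire l => exact absurd (RS.acq_mem _ _ _ ((enabled_acq _ _ _).1 he).1) h
    | release l => exact absurd (RS.rel_mem _ _ _ ((enabled_rel _ _ _).1 he).1) h
    | exit => exact absurd he (enabled_exit hnb _ _)
    | nsync m => exact ((enabled_nsync _ _ _).1 he).1
  · rintro ⟨h, hk⟩
    obtain ⟨m, hm⟩ := P.stmtsNonempty i _ hk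
    exact ⟨h, .nsync m, (enabled_nsync _ _ _).2 ⟨hk, hm⟩⟩

theorem normal_congr (hnb : NoBarriers P) (RS : RSets P) {s s' : GState P} {i : Fin P.n}
    (h : s.loc i = s'.loc i) : Normal RS s i ↔ Normal RS s' i := by
  rw [normal_iff hnb, normal_iff hnb, h]

/-- static independence of `e` followed by `t`. -/
def Indep (C : GStmt P → GStmt P → Prop) (e t : GStmt P) : Prop :=
  ¬ C e t ∧ ∀ l, ¬ (e.isReleaseOn l ∧ t.isAcquireOn l)

theorem comm1 (hnb : NoBarriers P) {C : GStmt P → GStmt P → Prop} (hC : IsConflictRel P C)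
    (z : GState P) (e t : GStmt P) (hne : t.1 ≠ e.1) (hi : Indep C e t)
    (he : Enabled z e) (ht : Enabled (execute z e) t) :
    Enabled z t ∧ Enabled (execute z t) e ∧
      execute (execute z t) e = execute (execute z e) t := by
  obtain ⟨a, e⟩ := e
  obtain ⟨b, t⟩ := t
  simp only at hne
  have hne' : a ≠ b := fun h => hne h.symm
  obtain ⟨hc, hl⟩ := hi
  cases e with
  | exit => exact absurd he (enabled_exit hnb _ _)
  | acquire l =>
    cases t with
    | exit => exact absurd ht (enabled_exit hnb _ _)
    | acquire l' =>
      simp only [enabled_acq, exec_acq hnb, Function.update_of_ne hne, Function.update_of_ne hne',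
        GState.mk.injEq] at *
      by_cases h : l' = l
      · simp [h] at ht
      · simp only [if_neg h] at ht
        refine ⟨ht, ⟨he.1, ?_⟩, Function.update_comm hne' _ _ _ |>.symm, trivial, ?_, trivial⟩
        · rw [if_neg (fun x => h x.symm)]; exact he.2
        · funext x; split_ifs <;> simp_all
    | release l' =>
      simp only [enabled_acq, enabled_rel, exec_acq hnb, exec_rel hnb, Function.update_of_ne hne,
        Function.update_of_ne hne', GState.mk.injEq] at *
      by_cases h : l' = l
      · simp [h] at ht; exact absurd ht.2 hne'
      · simp only [if_neg h] at ht
        refine ⟨ht, ⟨he.1, ?_⟩, Function.update_comm hne' _ _ _ |>.symm, trivial, ?_, trivial⟩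
        · rw [if_neg (fun x => h x.symm)]; exact he.2
        · funext x; split_ifs <;> simp_all
    | nsync m =>
      simp only [enabled_acq, enabled_nsync, exec_acq hnb, exec_nsync hnb,
        Function.update_of_ne hne, Function.update_of_ne hne', GState.mk.injEq] at *
      exact ⟨ht, he, Function.update_comm hne' _ _ _ |>.symm, by trivial, by trivial, by trivial⟩
  | release l =>
    cases t with
    | exit => exact absurd ht (enabled_exit hnb _ _)
    | acquire l' =>
      have h : l' ≠ l := by
        rintro rfl
        exact hl l' ⟨rfl, rfl⟩
      simp only [enabled_acq, enabled_rel, exec_acq hnb, exec_rel hnb, Function.update_of_ne hne,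
        Function.update_of_ne hne', GState.mk.injEq] at *
      simp only [if_neg h] at ht
      refine ⟨ht, ⟨he.1, ?_⟩, Function.update_comm hne' _ _ _ |>.symm, trivial, ?_, trivial⟩
      · rw [if_neg (fun x => h x.symm)]; exact he.2
      · funext x; split_ifs <;> simp_all
    | release l' =>
      simp only [enabled_rel, exec_rel hnb, Function.update_of_ne hne,
        Function.update_of_ne hne', GState.mk.injEq] at *
      by_cases h : l' = l
      · simp [h] at ht
      · simp only [if_neg h] at ht
        refine ⟨ht, ⟨he.1, ?_⟩, Function.update_comm hne' _ _ _ |>.symm, trivial, ?_, trivial⟩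
        · rw [if_neg (fun x => h x.symm)]; exact he.2
        · funext x; split_ifs <;> simp_all
    | nsync m =>
      simp only [enabled_rel, enabled_nsync, exec_rel hnb, exec_nsync hnb,
        Function.update_of_ne hne, Function.update_of_ne hne', GState.mk.injEq] at *
      exact ⟨ht, he, Function.update_comm hne' _ _ _ |>.symm, by trivial, by trivial, by trivial⟩
  | nsync m =>
    cases t with
    | exit => exact absurd ht (enabled_exit hnb _ _)
    | acquire l' =>
      simp only [enabled_acq, enabled_nsync, exec_acq hnb, exec_nsync hnb,
        Function.update_of_ne hne, Function.update_of_ne hne', GState.mk.injEq] at *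
      exact ⟨ht, he, Function.update_comm hne' _ _ _ |>.symm, by trivial, by trivial, by trivial⟩
    | release l' =>
      simp only [enabled_rel, enabled_nsync, exec_rel hnb, exec_nsync hnb,
        Function.update_of_ne hne, Function.update_of_ne hne', GState.mk.injEq] at *
      exact ⟨ht, he, Function.update_comm hne' _ _ _ |>.symm, by trivial, by trivial, by trivial⟩
    | nsync m' =>
      have ht' : Enabled z ⟨b, .nsync m'⟩ := by
        simp only [enabled_nsync, exec_nsync hnb, Function.update_of_ne hne] at *
        exact ht
      refine ⟨ht', ?_, ?_⟩
      · simp only [enabled_nsync, exec_nsync hnb, Function.update_of_ne hne'] at *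
        exact he
      · exact (hC.commute _ _ ⟨m, rfl⟩ ⟨m', rfl⟩ hne' hc z he ht').symm

/-! state-level paths -/

def SE (RS : RSets P) (s : GState P) (t : GStmt P) : Prop :=
  Enabled s t ∧ ((∃ i, Normal RS s i) → Normal RS s t.1 ∧ ∀ j, Normal RS s j → t.1 ≤ j)

noncomputable def run (s : GState P) (l : List (GStmt P)) : GState P := l.foldl execute s

def Val : GState P → List (GStmt P) → Prop
  | _, [] => True
  | s, t :: l => Enabled s t ∧ Val (execute s t) l

def NR (RS : RSets P) (a : Fin P.n) : GState P → List (GStmt P) → Prop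
  | s, [] => ¬ Normal RS s a
  | s, t :: r => Normal RS s a ∧ t.1 = a ∧ SE RS s t ∧ NR RS a (execute s t) r

def BL (RS : RSets P) (s : GState P) : List (GStmt P) → Prop
  | [] => False
  | t :: r => SE RS s t ∧ NR RS t.1 (execute s t) r

def CP (RS : RSets P) : GState P → List (List (GStmt P)) → Prop
  | _, [] => True
  | s, b :: bs => BL RS s b ∧ CP RS (run s b) bs

@[simp] theorem run_nil (s : GState P) : run s [] = s := rfl
@[simp] theorem run_cons (s : GState P) (t l) : run s (t :: l) = run (execute s t) l := rfl
theorem run_append (s : GState P) (l l') : run s (l ++ l') = run (run s l) l' := by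
  simp [run]

theorem Val_append (s : GState P) (l l') : Val s (l ++ l') ↔ Val s l ∧ Val (run s l) l' := by
  induction l generalizing s with
  | nil => simp [Val]
  | cons t l ih => simp [Val, ih, and_assoc]

theorem CP_append (RS : RSets P) (s : GState P) (A B) :
    CP RS s (A ++ B) ↔ CP RS s A ∧ CP RS (run s A.flatten) B := by
  induction A generalizing s with
  | nil => simp [CP]
  | cons t l ih => simp [CP, ih, and_assoc, run_append]

theorem NR_val {RS : RSets P} {a s r} (h : NR RS a s r) : Val s r ∧ ∀ t ∈ r, t.1 = a := by
  induction r generalizing s with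
  | nil => simp [Val]
  | cons t r ih =>
    obtain ⟨h1, h2, h3, h4⟩ := h
    have := ih h4
    exact ⟨⟨h3.1, this.1⟩, by simpa [h2] using this.2⟩

theorem BL_val {RS : RSets P} {s b} (h : BL RS s b) : Val s b := by
  cases b with
  | nil => exact h.elim
  | cons t r => exact ⟨h.1.1, (NR_val h.2).1⟩

theorem CP_val {RS : RSets P} {s bs} (h : CP RS s bs) : Val s bs.flatten := by
  induction bs generalizing s with
  | nil => simp [Val]
  | cons b bs ih =>
    rw [List.flatten_cons, Val_append]
    exact ⟨BL_val h.1, ih h.2⟩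

theorem run_loc_ne (s : GState P) (l : List (GStmt P)) (i : Fin P.n) (h : ∀ t ∈ l, t.1 ≠ i) :
    (run s l).loc i = s.loc i := by
  induction l generalizing s with
  | nil => rfl
  | cons t l ih =>
    rw [run_cons, ih _ (fun t ht => h t (List.mem_cons_of_mem _ ht)), exec_loc_ne]
    exact (h t (List.mem_cons_self)).symm

/-! Removal of a block -/

theorem commL (hnb : NoBarriers P) {C : GStmt P → GStmt P → Prop} (hC : IsConflictRel P C)
    (z : GState P) (b : List (GStmt P)) (t : GStmt P) (hi : ∀ e ∈ b, t.1 ≠ e.1 ∧ Indep C e t)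
    (hb : Val z b) (ht : Enabled (run z b) t) :
    Enabled z t ∧ Val (execute z t) b ∧ run (execute z t) b = execute (run z b) t := by
  induction b generalizing z with
  | nil => exact ⟨ht, trivial, rfl⟩
  | cons e b ih =>
    obtain ⟨h1, h2⟩ := hb
    obtain ⟨g1, g2, g3⟩ := ih (execute z e) (fun x hx => hi x (List.mem_cons_of_mem _ hx)) h2 ht
    obtain ⟨k1, k2, k3⟩ := comm1 hnb hC z e t (hi e List.mem_cons_self).1
      (hi e List.mem_cons_self).2 h1 g1
    exact ⟨k1, ⟨k2, by rw [k3]; exact g2⟩, by rw [run_cons, k3, g3]; rfl⟩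

/-- `b` (of thread `a`) can be postponed past everything from `y`, reaching `x`. -/
def RI (RS : RSets P) (a : Fin P.n) (b : List (GStmt P)) (x y : GState P) : Prop :=
  Val y b ∧ x = run y b ∧ ¬ Normal RS y a

theorem RI_normal (hnb : NoBarriers P) {RS : RSets P} {a b} (hb : ∀ e ∈ b, e.1 = a)
    {x y : GState P} (h : RI RS a b x y) (i : Fin P.n) (hi : i ≠ a) :
    Normal RS y i ↔ Normal RS x i := by
  apply normal_congr hnb
  rw [h.2.1, run_loc_ne]
  intro t ht; rw [hb t ht]; exact hi.symm

theorem RI_step (hnb : NoBarriers P) {C : GStmt P → GStmt P → Prop} (hC : IsConflictRel P C)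
    {RS : RSets P} {a b} (hb : ∀ e ∈ b, e.1 = a)
    {x y : GState P} (h : RI RS a b x y) (t : GStmt P) (ht : SE RS x t)
    (hta : t.1 ≠ a) (hi : ∀ e ∈ b, Indep C e t) :
    SE RS y t ∧ RI RS a b (execute x t) (execute y t) := by
  have hN := RI_normal hnb hb h
  obtain ⟨h1, rfl, h3⟩ := h
  obtain ⟨g1, g2, g3⟩ := commL hnb hC y b t (fun e he => ⟨by rw [hb e he]; exact hta, hi e he⟩)
    h1 ht.1
  refine ⟨⟨g1, ?_⟩, g2, g3.symm, ?_⟩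
  · rintro ⟨i, hi⟩
    have hia : ∀ j, Normal RS y j → j ≠ a := fun j hj hja => h3 (hja ▸ hj)
    obtain ⟨k1, k2⟩ := ht.2 ⟨i, (hN i (hia i hi)).1 hi⟩
    exact ⟨(hN _ hta).2 k1, fun j hj => k2 j ((hN j (hia j hj)).1 hj)⟩
  · rwa [normal_congr hnb RS (exec_loc_ne y t a hta.symm)]

theorem RI_NR (hnb : NoBarriers P) {C : GStmt P → GStmt P → Prop} (hC : IsConflictRel P C)
    {RS : RSets P} {a b} (hb : ∀ e ∈ b, e.1 = a)
    {x y : GState P} (h : RI RS a b x y) {c : Fin P.n} (hca : c ≠ a) (r : List (GStmt P))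
    (hr : NR RS c x r) (hi : ∀ t ∈ r, ∀ e ∈ b, Indep C e t) :
    NR RS c y r ∧ RI RS a b (run x r) (run y r) := by
  induction r generalizing x y with
  | nil => exact ⟨fun h' => hr ((RI_normal hnb hb h c hca).1 h'), h⟩
  | cons t r ih =>
    obtain ⟨h1, h2, h3, h4⟩ := hr
    obtain ⟨g1, g2⟩ := RI_step hnb hC hb h t h3 (by rw [h2]; exact hca) (hi t List.mem_cons_self)
    obtain ⟨k1, k2⟩ := ih g2 h4 (fun t ht => hi t (List.mem_cons_of_mem _ ht))
    exact ⟨⟨(RI_normal hnb hb h c hca).2 h1, h2, g1, k1⟩, k2⟩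

theorem RI_CP (hnb : NoBarriers P) {C : GStmt P → GStmt P → Prop} (hC : IsConflictRel P C)
    {RS : RSets P} {a b} (hb : ∀ e ∈ b, e.1 = a)
    {x y : GState P} (h : RI RS a b x y) (bs : List (List (GStmt P)))
    (hr : CP RS x bs) (hi : ∀ t ∈ bs.flatten, t.1 ≠ a ∧ ∀ e ∈ b, Indep C e t) :
    CP RS y bs := by
  induction bs generalizing x y with
  | nil => trivial
  | cons d bs ih =>
    obtain ⟨h1, h2⟩ := hr
    cases d with
    | nil => exact h1.elim
    | cons t r =>
      obtain ⟨h3, h4⟩ := h1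
      have ht := hi t (by simp)
      obtain ⟨g1, g2⟩ := RI_step hnb hC hb h t h3 ht.1 ht.2
      obtain ⟨k1, k2⟩ := RI_NR hnb hC hb g2 ht.1 r h4 (fun t ht => (hi t (by simp [ht])).2)
      exact ⟨⟨g1, k1⟩, ih k2 h2 (fun t ht => hi t (by rw [List.flatten_cons]; exact List.mem_append_right _ ht))⟩

theorem CP_nonnormal (hnb : NoBarriers P) {RS : RSets P} {s : GState P} {bs} (h : CP RS s bs)
    (a : Fin P.n) (ha : ¬ Normal RS s a ∨ ∃ t ∈ bs.flatten, t.1 = a) :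
    ¬ Normal RS (run s bs.flatten) a := by
  induction bs generalizing s with
  | nil => simpa using ha
  | cons d bs ih =>
    obtain ⟨h1, h2⟩ := h
    rw [List.flatten_cons, run_append]
    apply ih h2
    cases d with
    | nil => exact h1.elim
    | cons t r =>
      obtain ⟨h3, h4⟩ := h1
      have hall : ∀ e ∈ t :: r, e.1 = t.1 := by simpa using (NR_val h4).2
      by_cases hta : t.1 = a
      · left
        subst hta
        have key : ∀ (r : List (GStmt P)) (s : GState P) (c : Fin P.n),
            NR RS c s r → ¬ Normal RS (run s r) c := by
          intro r
          induction r with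
          | nil => intro s c h; exact h
          | cons t r ih => intro s c h; exact ih _ _ h.2.2.2
        exact key r (execute s t) _ h4
      · rcases ha with ha | ⟨e, he, hea⟩
        · left
          rw [normal_congr hnb RS (run_loc_ne s (t :: r) a (fun e he => by rw [hall e he]; exact hta))]
          exact ha
        · rw [List.flatten_cons, List.mem_append] at he
          rcases he with he | he
          · exact absurd ((hall e he).symm.trans hea) hta
          · exact Or.inr ⟨e, he, hea⟩

/-! traces -/

theorem val_noexit (hnb : NoBarriers P) {s : GState P} {l} (h : Val s l) :
    ∀ t ∈ l, ¬ t.isExit := by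
  induction l generalizing s with
  | nil => simp
  | cons t l ih =>
    intro e he
    rcases List.mem_cons.1 he with rfl | he
    · obtain ⟨i, st⟩ := e
      rintro hx
      simp only [GStmt.isExit] at hx
      subst hx
      exact enabled_exit hnb _ _ h.1
    · exact ih h.2 e he

theorem no_barrierRel {l : List (GStmt P)} (h : ∀ t ∈ l, ¬ t.isExit) (j k : ℕ) :
    ¬ BarrierRel l j k := by
  have : ∀ k, epoch l k = 0 := by
    intro k
    unfold epoch
    convert Set.ncard_empty ℕ
    ext m
    simp only [Set.mem_ofPred_eq, Set.mem_empty_iff_false, iff_false]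
    rintro ⟨-, -, t, ht, hx⟩
    exact h t (List.mem_of_getElem? ht) hx
  rintro ⟨-, -, h3⟩
  rw [this, this] at h3
  exact absurd h3 (lt_irrefl _)

theorem stmtIs_lt {l : List (GStmt P)} {k p} (h : stmtIs l k p) : k < l.length := by
  obtain ⟨t, ht, -⟩ := h
  exact (List.getElem?_eq_some_iff.1 ht).1

theorem HB_lt {l : List (GStmt P)} (h : ∀ t ∈ l, ¬ t.isExit) {j k : ℕ} (hb : HB l j k) :
    j < k ∧ k < l.length := by
  have step : ∀ j k, (IntraThread l j k ∨ RelAcq l j k ∨ BarrierRel l j k) →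
      j < k ∧ k < l.length := by
    rintro j k (h1 | ⟨x, h1, h2, h3, h4⟩ | h1)
    · exact ⟨h1.1, h1.2.1⟩
    · exact ⟨h1, stmtIs_lt h3⟩
    · exact absurd h1 (no_barrierRel h _ _)
  induction hb with
  | single h1 => exact step _ _ h1
  | tail _ h1 ih => have := step _ _ h1; omega

theorem HB_intra {l : List (GStmt P)} {j k : ℕ} (h : j < k) (hk : k < l.length)
    (ht : tidAt l j = tidAt l k) : HB l j k :=
  Relation.TransGen.single (Or.inl ⟨h, hk, ht⟩)

theorem val_at {s : GState P} {l} (h : Val s l) {k t} (hk : l[k]? = some t) :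
    Enabled (run s (l.take k)) t ∧ run s (l.take (k+1)) = execute (run s (l.take k)) t := by
  obtain ⟨hk1, hk2⟩ := List.getElem?_eq_some_iff.1 hk
  constructor
  · have : l = l.take k ++ t :: l.drop (k+1) := by
      rw [← hk2]; simp
    rw [this, Val_append] at h
    exact h.2.1
  · rw [← List.take_concat_get' l k hk1, run_append, hk2]; rfl

theorem lk_step (hnb : NoBarriers P) (s : GState P) (t : GStmt P) (he : Enabled s t) (x : P.Lock) :
    (t.isAcquireOn x ∧ s.lk x = none ∧ (execute s t).lk x = some t.1) ∨
    (t.isReleaseOn x ∧ s.lk x = some t.1 ∧ (execute s t).lk x = none) ∨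
    (¬ t.isAcquireOn x ∧ ¬ t.isReleaseOn x ∧ (execute s t).lk x = s.lk x) := by
  obtain ⟨i, st⟩ := t
  cases st with
  | exit => exact absurd he (enabled_exit hnb _ _)
  | acquire l =>
    rw [enabled_acq] at he
    simp only [GStmt.isAcquireOn, GStmt.isReleaseOn, exec_acq hnb, Stmt.acquire.injEq]
    by_cases h : l = x
    · subst h; simp [he.2]
    · simp [h]
      intro h1
      exact absurd h1.symm h
  | release l =>
    rw [enabled_rel] at he
    simp only [GStmt.isAcquireOn, GStmt.isReleaseOn, exec_rel hnb, Stmt.release.injEq]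
    by_cases h : l = x
    · subst h; simp [he.2]
    · simp [h]
      intro h1
      exact absurd h1.symm h
  | nsync m =>
    simp [GStmt.isAcquireOn, GStmt.isReleaseOn, exec_nsync hnb]

theorem HB_lock (hnb : NoBarriers P) {s : GState P} {l} (h : Val s l) (x : P.Lock) {j k : ℕ}
    (hjk : j < k) (hj : stmtIs l j (·.isReleaseOn x)) (hk : stmtIs l k (·.isAcquireOn x)) :
    HB l j k := by
  have hkl := stmtIs_lt hk
  have Q : ∀ m, j + 1 ≤ m → m ≤ k →
      (∃ r i, r < m ∧ (r = j ∨ HB l j r) ∧ tidAt l r = some i ∧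
        (run s (l.take m)).lk x = some i) ∨
      ((run s (l.take m)).lk x = none ∧ ∃ r, r < m ∧ (r = j ∨ HB l j r) ∧
        stmtIs l r (·.isReleaseOn x) ∧ ∀ m', r < m' → m' < m → ¬ stmtIs l m' (·.isAcquireOn x)) := by
    intro m hm
    induction m, hm using Nat.le_induction with
    | base =>
      intro _
      right
      obtain ⟨t, ht, hr⟩ := hj
      obtain ⟨e1, e2⟩ := val_at h ht
      rw [e2]
      refine ⟨?_, j, by omega, Or.inl rfl, ⟨t, ht, hr⟩, fun m' _ _ => by omega⟩
      rcases lk_step hnb _ t e1 x with h1 | h1 | h1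
      · have := h1.1; simp_all [GStmt.isAcquireOn, GStmt.isReleaseOn]
      · exact h1.2.2
      · exact absurd hr h1.2.1
    | succ m hm ih =>
      intro hmk
      have ih := ih (by omega)
      have hml : m < l.length := by omega
      have ht : l[m]? = some l[m] := List.getElem?_eq_getElem hml
      obtain ⟨e1, e2⟩ := val_at h ht
      have htid : tidAt l m = some l[m].1 := by simp [tidAt, ht]
      rw [e2]
      rcases lk_step hnb _ l[m] e1 x with h1 | h1 | h1
      · left
        rcases ih with ⟨r, i, h2, h3, h4, h5⟩ | ⟨h2, r, h3, h4, h5, h6⟩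
        · rw [h1.2.1] at h5; simp at h5
        · refine ⟨m, l[m].1, by omega, Or.inr ?_, htid, h1.2.2⟩
          have hs : HB l r m := Relation.TransGen.single
            (Or.inr (Or.inl ⟨x, h3, h5, ⟨_, ht, h1.1⟩, h6⟩))
          rcases h4 with rfl | h4
          · exact hs
          · exact h4.trans hs
      · right
        rcases ih with ⟨r, i, h2, h3, h4, h5⟩ | ⟨h2, r, h3, h4, h5, h6⟩
        · refine ⟨h1.2.2, m, by omega, Or.inr ?_, ⟨_, ht, h1.1⟩, fun m' _ _ => by omega⟩
          have hs : HB l r m := HB_intra h2 hml (by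
            rw [h4, htid, ← h1.2.1, h5])
          rcases h3 with rfl | h3
          · exact hs
          · exact h3.trans hs
        · rw [h1.2.1] at h2; simp at h2
      · rcases ih with ⟨r, i, h2, h3, h4, h5⟩ | ⟨h2, r, h3, h4, h5, h6⟩
        · exact Or.inl ⟨r, i, by omega, h3, h4, by rw [h1.2.2, h5]⟩
        · refine Or.inr ⟨by rw [h1.2.2, h2], r, by omega, h4, h5, ?_⟩
          intro m' g1 g2
          by_cases hm' : m' = m
          · subst hm'
            rintro ⟨t, ht', hta⟩
            rw [ht] at ht'
            cases ht'
            exact h1.1 hta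
          · exact h6 m' g1 (by omega)
  obtain ⟨t, ht, ha⟩ := hk
  obtain ⟨e1, e2⟩ := val_at h ht
  have hlk : (run s (l.take k)).lk x = none := by
    rcases lk_step hnb _ t e1 x with h1 | h1 | h1
    · exact h1.2.1
    · have := h1.1; simp_all [GStmt.isAcquireOn, GStmt.isReleaseOn]
    · exact absurd ha h1.1
  rcases Q k (by omega) le_rfl with ⟨r, i, h2, h3, h4, h5⟩ | ⟨h2, r, h3, h4, h5, h6⟩
  · rw [hlk] at h5; simp at h5
  · have hs : HB l r k := Relation.TransGen.single
      (Or.inr (Or.inl ⟨x, h3, h5, ⟨_, ht, ha⟩, h6⟩))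
    rcases h4 with rfl | h4
    · exact hs
    · exact h4.trans hs

theorem HB_map (hnb : NoBarriers P) {s : GState P} {l l' : List (GStmt P)} (h : Val s l)
    (φ : ℕ → ℕ) (hφ : ∀ a b, a < b → φ a < φ b)
    (hl : ∀ m, m < l'.length → l[φ m]? = l'[m]?) {j k : ℕ} (hb : HB l' j k) :
    HB l (φ j) (φ k) := by
  have hx : ∀ t ∈ l', ¬ t.isExit := by
    intro t ht
    obtain ⟨m, hm, rfl⟩ := List.getElem_of_mem ht
    apply val_noexit hnb h
    apply List.mem_of_getElem? (i := φ m)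
    rw [hl m hm, List.getElem?_eq_getElem hm]
  have hs : ∀ m p, stmtIs l' m p → stmtIs l (φ m) p := by
    intro m p hm
    have := stmtIs_lt hm
    obtain ⟨t, ht, hp⟩ := hm
    exact ⟨t, by rw [hl m this, ht], hp⟩
  have step : ∀ j k, (IntraThread l' j k ∨ RelAcq l' j k ∨ BarrierRel l' j k) →
      HB l (φ j) (φ k) := by
    rintro j k (⟨h1, h2, h3⟩ | ⟨x, h1, h2, h3, h4⟩ | h1)
    · apply HB_intra (hφ _ _ h1)
      · have := hl k h2
        rw [List.getElem?_eq_getElem h2] at this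
        exact (List.getElem?_eq_some_iff.1 this).1
      · unfold tidAt at *
        rw [hl k h2, hl j (h1.trans h2), h3]
    · exact HB_lock hnb h x (hφ _ _ h1) (hs _ _ h2) (hs _ _ h3)
    · exact absurd h1 (no_barrierRel hx _ _)
  induction hb with
  | single h1 => exact step _ _ h1
  | tail _ h1 ih => exact Relation.TransGen.trans ih (step _ _ h1)

/-! From graph paths to complete block paths -/

theorem redge_SE {RS : RSets P} {u v : RNode P} {t} (h : REdge RS u t v) :
    SE RS u.st t ∧ v.st = execute u.st t := ⟨⟨h.1, h.2.2.2.2.2⟩, h.2.1⟩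

open Classical in
theorem SE_lift (hnb : NoBarriers P) {RS : RSets P} (u : RNode P) (t : GStmt P)
    (h : SE RS u.st t) : ∃ v, REdge RS u t v := by
  have hx : ¬ t.isExitZero := by
    obtain ⟨i, st⟩ := t
    rintro ⟨h1, -⟩
    simp only at h1
    subst h1
    exact enabled_exit hnb _ _ h.1
  obtain ⟨i, st⟩ := t
  refine ⟨⟨execute u.st ⟨i, st⟩, Function.update u.hist i
    (match st with
      | .nsync m => insert m (u.hist i)
      | _ => if u.st.loc i ∈ RS.R i then ∅ else u.hist i)⟩, h.1, rfl, ?_, ?_, ?_, h.2⟩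
  · intro m hm
    have hm2 : st = Stmt.nsync (NStmt := P.NStmt i) m := hm
    clear hm
    cases st with
    | nsync k =>
      injection hm2 with e
      subst e
      exact Function.update_self _ _ _
    | _ => cases hm2
  · intro hn
    simp only [hx, false_or]
    cases st with
    | nsync m => exact absurd ⟨m, rfl⟩ hn
    | _ => constructor <;> intro h <;> simp [h]
  · intro j hj
    refine ⟨fun h => absurd h hx, fun _ => ?_⟩
    exact Function.update_of_ne hj _ _

def Inv (RS : RSets P) (s : GState P) (a : Fin P.n) : Prop := ∀ j, Normal RS s j → a ≤ j

theorem SE_inv (hnb : NoBarriers P) {RS : RSets P} {s : GState P} {t} (h : SE RS s t) :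
    Inv RS (execute s t) t.1 := by
  intro j hj
  by_cases hjt : j = t.1
  · rw [hjt]
  · rw [normal_congr hnb RS (exec_loc_ne s t j hjt)] at hj
    exact (h.2 ⟨j, hj⟩).2 j hj

theorem RReach_snoc {RS : RSets P} {u v w : RNode P} {t} (h : RReach RS u v) (he : REdge RS v t w) :
    RReach RS u w := by
  obtain ⟨l, hl⟩ := h
  refine ⟨l ++ [t], ?_⟩
  induction hl with
  | nil u => exact .cons he (.nil _)
  | cons h1 h2 ih => exact .cons h1 (ih he)

theorem NR_term (hnb : NoBarriers P) {RS : RSets P} {u0 : RNode P}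
    (hfin : {v | RReach RS u0 v}.Finite) (a : Fin P.n) (u : RNode P) (hu : RReach RS u0 u)
    (hi : Inv RS u.st a) : ∃ r, NR RS a u.st r := by
  have : Finite {v | RReach RS u0 v} := hfin
  let L : P.Local a → P.Local a → Prop :=
    Relation.TransGen (fun x y => x ∉ RS.R a ∧ y ∉ RS.R a ∧ isLocalStep a x y)
  let r : {v | RReach RS u0 v} → {v | RReach RS u0 v} → Prop :=
    fun x y => L (y.1.st.loc a) (x.1.st.loc a)
  have : IsTrans _ r := ⟨fun x y z h1 h2 => Relation.TransGen.trans h2 h1⟩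
  have : Std.Irrefl r := ⟨fun x h => by
    have h' : L (x.1.st.loc a) (x.1.st.loc a) := h
    have hx : x.1.st.loc a ∉ RS.R a := by
      rcases Relation.TransGen.head'_iff.1 h' with ⟨c, hc, -⟩
      exact hc.1
    exact RS.acyclic a _ hx h'⟩
  have wf : WellFounded r := Finite.wellFounded_of_trans_of_irrefl r
  suffices H : ∀ x : {v | RReach RS u0 v}, Inv RS x.1.st a → ∃ r, NR RS a x.1.st r from
    H ⟨u, hu⟩ hi
  intro x
  induction x using wf.induction with
  | _ x ih =>
  intro hi
  by_cases hn : Normal RS x.1.st a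
  · have hn' := (normal_iff hnb RS _ _).1 hn
    obtain ⟨m, hm⟩ := P.stmtsNonempty a _ hn'.2
    have hse : SE RS x.1.st ⟨a, .nsync m⟩ :=
      ⟨(enabled_nsync _ _ _).2 ⟨hn'.2, hm⟩, fun _ => ⟨hn, hi⟩⟩
    obtain ⟨v, hv⟩ := SE_lift hnb x.1 _ hse
    have hvst := (redge_SE hv).2
    by_cases hnv : Normal RS v.st a
    · have hnv' := (normal_iff hnb RS _ _).1 hnv
      have hloc : v.st.loc a = (P.update a (x.1.st.loc a) m x.1.st.sh).1 := by
        rw [hvst, exec_nsync hnb]; simp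
      obtain ⟨r', hr'⟩ := ih ⟨v, RReach_snoc x.2 hv⟩ (by
        apply Relation.TransGen.single
        refine ⟨hn'.1, hnv'.1, ?_⟩
        unfold isLocalStep
        rw [hn'.2]
        exact ⟨m, _, hm, hloc.symm⟩) (by
          have := SE_inv hnb hse
          rw [← hvst] at this
          exact this)
      exact ⟨⟨a, .nsync m⟩ :: r', hn, rfl, hse, by rw [← hvst]; exact hr'⟩
    · exact ⟨[⟨a, .nsync m⟩], hn, rfl, hse, by rw [← hvst]; exact hnv⟩
  · exact ⟨[], hn⟩

theorem RPath_CP (hnb : NoBarriers P) {RS : RSets P} {u0 : RNode P}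
    (hfin : {v | RReach RS u0 v}.Finite) {u v : RNode P} {l} (h : RPath RS u l v)
    (hu : RReach RS u0 u) :
    (∃ bs l', CP RS u.st bs ∧ bs.flatten = l ++ l') ∧
    (∀ a, Inv RS u.st a → ∃ r bs l', NR RS a u.st r ∧ CP RS (run u.st r) bs ∧
      r ++ bs.flatten = l ++ l') := by
  induction h with
  | nil u =>
    refine ⟨⟨[], [], trivial, rfl⟩, fun a ha => ?_⟩
    obtain ⟨r, hr⟩ := NR_term hnb hfin a u hu ha
    exact ⟨r, [], r, hr, trivial, by simp⟩
  | @cons u v w t l he hp ih =>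
    obtain ⟨hA, hB⟩ := ih (RReach_snoc hu he)
    obtain ⟨hse, hst⟩ := redge_SE he
    have A : ∃ bs l', CP RS u.st bs ∧ bs.flatten = (t :: l) ++ l' := by
      obtain ⟨r, bs, l', h1, h2, h3⟩ := hB t.1 (by rw [hst]; exact SE_inv hnb hse)
      rw [hst] at h1 h2
      exact ⟨(t :: r) :: bs, l', ⟨⟨hse, h1⟩, h2⟩, by simp [h3]⟩
    refine ⟨A, fun a ha => ?_⟩
    by_cases hn : Normal RS u.st a
    · have h4 := hse.2 ⟨a, hn⟩
      have hta : t.1 = a := le_antisymm (h4.2 a hn) (ha _ h4.1)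
      obtain ⟨r, bs, l', h1, h2, h3⟩ := hB t.1 (by rw [hst]; exact SE_inv hnb hse)
      rw [hst] at h1 h2
      rw [hta] at h1
      exact ⟨t :: r, bs, l', ⟨hn, hta, hse, h1⟩, h2, by simp [h3]⟩
    · obtain ⟨bs, l', h1, h2⟩ := A
      exact ⟨[], bs, l', hn, h1, h2⟩

/-! Block indices -/

def cst (bs : List (List (GStmt P))) (j : ℕ) : ℕ := (bs.take j).flatten.length

theorem split_at (bs : List (List (GStmt P))) (j : ℕ) (h : j < bs.length) :
    bs = bs.take j ++ bs[j] :: bs.drop (j+1) := by simp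

theorem cst_succ (bs : List (List (GStmt P))) (j : ℕ) (h : j < bs.length) :
    cst bs (j+1) = cst bs j + bs[j].length := by
  unfold cst
  rw [← List.take_concat_get' bs j h]
  simp only [List.flatten_append, List.length_append]
  simp

theorem cst_mono (bs : List (List (GStmt P))) {i j : ℕ} (h : i ≤ j) : cst bs i ≤ cst bs j := by
  unfold cst
  rw [← Nat.add_sub_cancel' h, List.take_add]
  simp only [List.flatten_append, List.length_append]
  omega

theorem cst_last (bs : List (List (GStmt P))) : cst bs bs.length = bs.flatten.length := by
  simp [cst]

theorem flat_at (bs : List (List (GStmt P))) (j : ℕ) (h : j < bs.length) (k : ℕ)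
    (hk : k < bs[j].length) : bs.flatten[cst bs j + k]? = some bs[j][k] := by
  have hfl : bs.flatten = (bs.take j).flatten ++ (bs[j] ++ (bs.drop (j+1)).flatten) := by
    conv_lhs => rw [split_at bs j h, List.flatten_append, List.flatten_cons]
  rw [hfl]
  unfold cst
  rw [List.getElem?_append_right (by omega), Nat.add_sub_cancel_left,
    List.getElem?_append_left hk, List.getElem?_eq_getElem hk]

theorem flat_take (bs : List (List (GStmt P))) (j : ℕ) (h : j < bs.length) (k : ℕ)
    (hk : k ≤ bs[j].length) :
    bs.flatten.take (cst bs j + k) = (bs.take j).flatten ++ bs[j].take k := by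
  have hfl : bs.flatten = (bs.take j).flatten ++ (bs[j] ++ (bs.drop (j+1)).flatten) := by
    conv_lhs => rw [split_at bs j h, List.flatten_append, List.flatten_cons]
  rw [hfl]
  unfold cst
  rw [List.take_length_add_append, List.take_append_of_le_length hk]

theorem find_block (bs : List (List (GStmt P))) (m : ℕ) (hm : m < bs.flatten.length) :
    ∃ j, ∃ h : j < bs.length, ∃ k, k < bs[j].length ∧ m = cst bs j + k := by
  have key : ∀ N, N ≤ bs.length → m < cst bs N →
      ∃ j, ∃ h : j < bs.length, ∃ k, k < bs[j].length ∧ m = cst bs j + k := by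
    intro N
    induction N with
    | zero => intro _ h; simp [cst] at h
    | succ N ih =>
      intro hN h
      by_cases h' : m < cst bs N
      · exact ih (by omega) h'
      · rw [cst_succ bs N (by omega)] at h
        exact ⟨N, by omega, m - cst bs N, by omega, by omega⟩
  exact key bs.length le_rfl (by rw [cst_last]; exact hm)

theorem NR_at {RS : RSets P} {a s r} (h : NR RS a s r) (k : ℕ) (hk : k < r.length) :
    r[k].1 = a ∧ Normal RS (run s (r.take k)) a ∧ SE RS (run s (r.take k)) r[k] := by
  induction r generalizing s k with
  | nil => simp at hk
  | cons t r ih =>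
    obtain ⟨h1, h2, h3, h4⟩ := h
    cases k with
    | zero => exact ⟨h2, h1, h3⟩
    | succ k => simpa using ih h4 k (by simpa using hk)

theorem NR_end {RS : RSets P} {a s r} (h : NR RS a s r) : ¬ Normal RS (run s r) a := by
  induction r generalizing s with
  | nil => exact h
  | cons t r ih => exact ih h.2.2.2

/-- facts about one block. -/
theorem BL_facts {RS : RSets P} {s b} (h : BL RS s b) :
    ∃ hb : 0 < b.length, (∀ k (hk : k < b.length), b[k].1 = b[0].1 ∧
      SE RS (run s (b.take k)) b[k] ∧ (0 < k → Normal RS (run s (b.take k)) b[0].1)) ∧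
      ¬ Normal RS (run s b) b[0].1 := by
  cases b with
  | nil => exact h.elim
  | cons t r =>
    refine ⟨by simp, ?_, NR_end (s := execute s t) (r := r) h.2⟩
    intro k hk
    cases k with
    | zero => exact ⟨rfl, h.1, fun h => absurd h (lt_irrefl _)⟩
    | succ k =>
      have := NR_at h.2 k (by simpa using hk)
      exact ⟨this.1, this.2.2, fun _ => this.2.1⟩

theorem CP_block {RS : RSets P} {s bs} (h : CP RS s bs) (j : ℕ) (hj : j < bs.length) :
    BL RS (run s (bs.take j).flatten) bs[j] := by
  rw [split_at bs j hj, CP_append] at h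
  exact h.2.1

theorem tid_at {RS : RSets P} {s bs} (h : CP RS s bs) (j : ℕ) (hj : j < bs.length) (k : ℕ)
    (hk : k < bs[j].length) : tidAt bs.flatten (cst bs j + k) = tidAt bs.flatten (cst bs j) := by
  obtain ⟨h0, h1, -⟩ := BL_facts (CP_block h j hj)
  have e1 := flat_at bs j hj k hk
  have e2 := flat_at bs j hj 0 h0
  rw [Nat.add_zero] at e2
  simp [tidAt, e1, e2, (h1 k hk).1]

/-- happens-before enters a block through its first event. -/
theorem HB_entry (hnb : NoBarriers P) {RS : RSets P} {s bs} (h : CP RS s bs) {p m : ℕ}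
    (hb : HB bs.flatten p m) : ∀ j (hj : j < bs.length) k, k < bs[j].length → m = cst bs j + k →
    p < cst bs j → HB bs.flatten p (cst bs j) := by
  have hV := CP_val h
  have hx := val_noexit hnb hV
  have step : ∀ p m, (IntraThread bs.flatten p m ∨ RelAcq bs.flatten p m ∨
      BarrierRel bs.flatten p m) → ∀ j (hj : j < bs.length) k, k < bs[j].length →
      m = cst bs j + k → p < cst bs j → HB bs.flatten p (cst bs j) := by
    rintro p m (⟨h1, h2, h3⟩ | ⟨x, h1, h2, h3, h4⟩ | h1) j hj k hk rfl hp
    · apply HB_intra hp (by omega)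
      rw [h3, tid_at h j hj k hk]
    · obtain ⟨h0, g1, -⟩ := BL_facts (CP_block h j hj)
      by_cases hk0 : k = 0
      · subst hk0
        exact Relation.TransGen.single (Or.inr (Or.inl ⟨x, h1, h2, h3, h4⟩))
      · exfalso
        obtain ⟨t, ht, hta⟩ := h3
        rw [flat_at bs j hj k hk] at ht
        obtain ⟨g2, g3, g4⟩ := g1 k hk
        have g4 := (normal_iff hnb _ _ _).1 (g4 (by omega))
        rw [← g2] at g4
        have g3 := g3.1
        injection ht with ht
        rw [ht] at g3 g4
        obtain ⟨i, st⟩ := t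
        simp only [GStmt.isAcquireOn] at hta
        subst hta
        have := ((enabled_acq _ _ _).1 g3).1
        rw [g4.2] at this
        cases this
    · exact absurd h1 (no_barrierRel hx _ _)
  induction hb with
  | single h1 => exact step _ _ h1
  | @tail b m h0 h1 ih =>
    intro j hj k hk hm hp
    by_cases hbj : b < cst bs j
    · exact h0.trans (step _ _ h1 j hj k hk hm hbj)
    · have hbm : b < m := (HB_lt hx (Relation.TransGen.single h1)).1
      exact ih j hj (b - cst bs j) (by omega) (by omega) hp

theorem Races_lt (hC : IsConflictRel P C) {l : List (GStmt P)} {p q}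
    (h : Races C l p q) : Races C l q p ∧ p ≠ q ∧ p < l.length ∧ q < l.length ∧
      tidAt l p ≠ tidAt l q := by
  obtain ⟨⟨t1, t2, h1, h2, h3⟩, h4, h5⟩ := h
  have ht : tidAt l p ≠ tidAt l q := by
    simp only [tidAt, h1, h2, Option.map_some, ne_eq, Option.some.injEq]
    exact hC.diff _ _ h3
  exact ⟨⟨⟨t2, t1, h2, h1, hC.symm _ _ h3⟩, h5, h4⟩, fun h => ht (by rw [h]),
    (List.getElem?_eq_some_iff.1 h1).1, (List.getElem?_eq_some_iff.1 h2).1, ht⟩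

/-- The state-level normal form. -/
def NF (RS : RSets P) (C : GStmt P → GStmt P → Prop) (s : GState P) : Prop :=
  ∃ bs, CP RS s bs ∧ ∃ i, i + 1 < bs.length ∧
    (∃ p q, cst bs i ≤ p ∧ p < cst bs (i+1) ∧ cst bs (bs.length-1) ≤ q ∧ q < cst bs bs.length ∧
      Races C bs.flatten p q) ∧
    (∀ j, i < j → j < bs.length → tidAt bs.flatten (cst bs j) ≠ tidAt bs.flatten (cst bs i))

theorem reduce (hnb : NoBarriers P) {RS : RSets P} (hC : IsConflictRel P C) {s : GState P} {bs}
    (h : CP RS s bs) (hr : HasRace C bs.flatten) :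
    NF RS C s ∨ ∃ bs', CP RS s bs' ∧ HasRace C bs'.flatten ∧ bs'.length < bs.length := by
  classical
  by_contra hcon
  rw [not_or] at hcon
  obtain ⟨hnf, hmin⟩ := hcon
  have hV := CP_val h
  have hx := val_noexit hnb hV
  -- choose the racing pair with `p < q` and `p` maximal
  obtain ⟨p, q, hpq, hrace, hmax⟩ : ∃ p q, p < q ∧ Races C bs.flatten p q ∧
      ∀ p' q', p < p' → p' < q' → ¬ Races C bs.flatten p' q' := by
    have hex : ∃ p, p ≤ bs.flatten.length ∧ ∃ q, p < q ∧ Races C bs.flatten p q := by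
      obtain ⟨p, q, hpq⟩ := hr
      obtain ⟨h1, h2, h3, h4, -⟩ := Races_lt hC hpq
      rcases lt_or_gt_of_ne h2 with h5 | h5
      · exact ⟨p, h3.le, q, h5, hpq⟩
      · exact ⟨q, h4.le, p, h5, h1⟩
    obtain ⟨p0, hp0, hp1⟩ := hex
    let Q : ℕ → Prop := fun p => ∃ q, p < q ∧ Races C bs.flatten p q
    obtain ⟨q, hq⟩ := Nat.findGreatest_spec (P := Q) hp0 hp1
    refine ⟨_, q, hq.1, hq.2, fun p' q' h1 h2 h3 => ?_⟩
    exact Nat.findGreatest_is_greatest (P := Q) h1 (Races_lt hC h3).2.2.1.le ⟨q', h2, h3⟩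
  obtain ⟨-, -, hpl, hql, htid⟩ := Races_lt hC hrace
  obtain ⟨i, hi, kp, hkp, hpe⟩ := find_block bs p hpl
  obtain ⟨n, hn, kq, hkq, hqe⟩ := find_block bs q hql
  -- `q` lies in the last block
  have hnl : n + 1 = bs.length := by
    by_contra hne
    apply hmin
    refine ⟨bs.take (n+1), ?_, ⟨p, q, ?_⟩, by rw [List.length_take]; omega⟩
    · rw [← List.take_append_drop (n+1) bs, CP_append] at h
      exact h.1
    · have hlen : (bs.take (n+1)).flatten.length = cst bs (n+1) := rfl
      have hq2 : q < cst bs (n+1) := by rw [cst_succ bs n hn]; omega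
      have hget : ∀ m, m < (bs.take (n+1)).flatten.length →
          bs.flatten[m]? = (bs.take (n+1)).flatten[m]? := by
        intro m hm
        conv_lhs => rw [← List.take_append_drop (n+1) bs, List.flatten_append]
        rw [List.getElem?_append_left hm]
      obtain ⟨⟨t1, t2, h1, h2, h3⟩, h4, h5⟩ := hrace
      rw [hget p (by omega)] at h1
      rw [hget q (by omega)] at h2
      exact ⟨⟨t1, t2, h1, h2, h3⟩, fun hb => h4 (HB_map hnb hV id (fun _ _ h => h) hget hb),
        fun hb => h5 (HB_map hnb hV id (fun _ _ h => h) hget hb)⟩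
  have hin : i < n := by
    rcases lt_trichotomy i n with h1 | h1 | h1
    · exact h1
    · subst h1
      exact absurd (by rw [hpe, hqe, tid_at h i hi kp hkp, tid_at h i hi kq hkq]) htid
    · have := cst_mono bs (show n + 1 ≤ i by omega)
      rw [cst_succ bs n hn] at this
      omega
  have hblk : ∀ j, (hj : j < bs.length) → 0 < bs[j].length := fun j hj =>
    (BL_facts (CP_block h j hj)).1
  have hc1 : ∀ j, i < j → p < cst bs j := by
    intro j hj
    have := cst_mono bs (show i + 1 ≤ j by omega)
    rw [cst_succ bs i hi] at this
    omega
  have hcl : ∀ j, j < bs.length → cst bs j < bs.flatten.length := by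
    intro j hj
    have := cst_mono bs (show j + 1 ≤ bs.length by omega)
    rw [cst_succ bs j hj, cst_last] at this
    have := hblk j hj
    omega
  have hpq' : ¬ HB bs.flatten p (cst bs n) := by
    intro hb
    by_cases hk : kq = 0
    · subst hk; rw [Nat.add_zero] at hqe; exact hrace.2.1 (hqe ▸ hb)
    · exact hrace.2.1 (hb.trans (HB_intra (by omega) hql (by rw [hqe, tid_at h n hn kq hkq])))
  -- a later block of the same thread gives a block to be removed
  have hex : ∃ k, k ≤ n ∧ (i < k ∧ HB bs.flatten p (cst bs k)) := by
    by_contra hno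
    apply hnf
    refine ⟨bs, h, i, by omega, ⟨p, q, by omega, by rw [cst_succ bs i hi]; omega, ?_, ?_, hrace⟩, ?_⟩
    · rw [← hnl, Nat.add_sub_cancel]; omega
    · rw [cst_last]; exact hql
    · intro j hij hj ht
      apply hno
      refine ⟨j, by omega, hij, HB_intra (hc1 j hij) (hcl j hj) ?_⟩
      rw [hpe, tid_at h i hi kp hkp, ht]
  obtain ⟨k, hkn, ⟨hik, hkb⟩, hkmax⟩ : ∃ k, k ≤ n ∧ (i < k ∧ HB bs.flatten p (cst bs k)) ∧
      ∀ k', k < k' → k' ≤ n → ¬ HB bs.flatten p (cst bs k') := by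
    obtain ⟨k0, hk0, hk1⟩ := hex
    let Q : ℕ → Prop := fun k => i < k ∧ HB bs.flatten p (cst bs k)
    have hs : Q (Nat.findGreatest Q n) := Nat.findGreatest_spec (P := Q) hk0 hk1
    refine ⟨Nat.findGreatest Q n, Nat.findGreatest_le n, hs, fun k' h1 h2 h3 => ?_⟩
    exact Nat.findGreatest_is_greatest (P := Q) h1 h2 ⟨hs.1.trans h1, h3⟩
  have hkn' : k < n := lt_of_le_of_ne hkn (fun hh => hpq' (hh ▸ hkb))
  have hk : k < bs.length := by omega
  obtain ⟨hb0, hbf, hbe⟩ := BL_facts (CP_block h k hk)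
  have hthr : ∀ e ∈ bs[k], e.1 = bs[k][0].1 := by
    intro e he
    obtain ⟨m, hm, rfl⟩ := List.getElem_of_mem he
    exact (hbf m hm).1
  have hlater : ∀ m, cst bs (k+1) ≤ m → m < bs.flatten.length → ¬ HB bs.flatten p m := by
    intro m hm1 hm2 hb
    obtain ⟨j, hj, r, hr, hme⟩ := find_block bs m hm2
    have hkj : k < j := by
      by_contra hkj
      have := cst_mono bs (show j + 1 ≤ k + 1 by omega)
      rw [cst_succ bs j hj] at this
      omega
    exact hkmax j hkj (by omega) (HB_entry hnb h hb j hj r hr hme (hc1 j (by omega)))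
  have hdl : bs.flatten = (bs.take (k+1)).flatten ++ (bs.drop (k+1)).flatten := by
    rw [← List.flatten_append, List.take_append_drop]
  have hind : ∀ t ∈ (bs.drop (k+1)).flatten, t.1 ≠ bs[k][0].1 ∧ ∀ e ∈ bs[k], Indep C e t := by
    intro t ht
    obtain ⟨m', hm', rfl⟩ := List.getElem_of_mem ht
    set t := (bs.drop (k+1)).flatten[m'] with htdef
    have hmt : bs.flatten[cst bs (k+1) + m']? = some t := by
      rw [hdl]
      unfold cst
      rw [List.getElem?_append_right (by omega), Nat.add_sub_cancel_left,
        List.getElem?_eq_getElem hm']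
    have hml : cst bs (k+1) + m' < bs.flatten.length := (List.getElem?_eq_some_iff.1 hmt).1
    have hnh := hlater _ (by omega) hml
    have key : ∀ (r : ℕ) (hr : r < bs[k].length), ¬ HB bs.flatten (cst bs k + r) (cst bs (k+1) + m') := by
      intro r hr hb
      apply hnh
      by_cases hr0 : r = 0
      · subst hr0; exact hkb.trans hb
      · refine (hkb.trans (HB_intra (by omega) ?_ (tid_at h k hk r hr).symm)).trans hb
        exact (List.getElem?_eq_some_iff.1 (flat_at bs k hk r hr)).1
    have hlt : ∀ (r : ℕ) (hr : r < bs[k].length), cst bs k + r < cst bs (k+1) + m' := by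
      intro r hr
      rw [cst_succ bs k hk]; omega
    refine ⟨fun heq => ?_, fun e he => ?_⟩
    · apply key 0 hb0
      apply HB_intra (hlt 0 hb0) hml
      rw [tidAt, tidAt, flat_at bs k hk 0 hb0, hmt]
      simp [heq]
    · obtain ⟨r, hr, rfl⟩ := List.getElem_of_mem he
      have he' := flat_at bs k hk r hr
      refine ⟨fun hc => ?_, fun x hx' => ?_⟩
      · refine hmax (cst bs k + r) (cst bs (k+1) + m') ?_ (hlt r hr)
          ⟨⟨_, _, he', hmt, hc⟩, key r hr, fun hb => ?_⟩
        · have := hc1 k hik; omega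
        · have := (HB_lt hx hb).1
          have := hlt r hr
          omega
      · exact key r hr (HB_lock hnb hV x (hlt r hr) ⟨_, he', hx'.1⟩ ⟨_, hmt, hx'.2⟩)
  -- the thread of block `k` is not normal at its start
  have hsplit := h
  rw [split_at bs k hk, CP_append] at hsplit
  obtain ⟨hpre, hbl, hpost⟩ := hsplit
  have hnn : ¬ Normal RS (run s (bs.take k).flatten) bs[k][0].1 := by
    have hfk := flat_at bs k hk 0 hb0
    rw [Nat.add_zero] at hfk
    have hcases : ∃ m, IntraThread bs.flatten m (cst bs k) ∨ RelAcq bs.flatten m (cst bs k) ∨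
        BarrierRel bs.flatten m (cst bs k) := by
      rcases Relation.TransGen.tail'_iff.1 hkb with ⟨m, -, hm⟩
      exact ⟨m, hm⟩
    obtain ⟨m, ⟨h1, h2, h3⟩ | ⟨x, h1, h2, ⟨t, ht, hta⟩, h4⟩ | h1⟩ := hcases
    · apply CP_nonnormal hnb hpre
      right
      have hm : m < (bs.take k).flatten.length := h1
      refine ⟨(bs.take k).flatten[m], List.getElem_mem _, ?_⟩
      have hm2 : bs.flatten[m]? = some (bs.take k).flatten[m] := by
        conv_lhs => rw [← List.take_append_drop k bs, List.flatten_append]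
        rw [List.getElem?_append_left hm, List.getElem?_eq_getElem hm]
      simpa [tidAt, hm2, hfk] using h3
    · intro hN
      have hN := (normal_iff hnb _ _ _).1 hN
      have hse := (hbf 0 hb0).2.1.1
      rw [hfk] at ht
      injection ht with ht
      rw [List.take_zero, run_nil] at hse
      rw [ht] at hN hse
      obtain ⟨i, st⟩ := t
      simp only [GStmt.isAcquireOn] at hta
      subst hta
      have := ((enabled_acq _ _ _).1 hse).1
      rw [hN.2] at this
      cases this
    · exact absurd h1 (no_barrierRel hx _ _)
  have hnew : CP RS s (bs.take k ++ bs.drop (k+1)) := by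
    rw [CP_append]
    exact ⟨hpre, RI_CP hnb hC hthr ⟨BL_val hbl, rfl, hnn⟩ _ hpost hind⟩
  apply hmin
  refine ⟨_, hnew, ?_, by simp; omega⟩
  -- the race survives
  have hsk := cst_succ bs k hk
  have hkq2 : cst bs (k+1) ≤ q := by
    have := cst_mono bs (show k + 1 ≤ n by omega)
    omega
  have hpk := hc1 k hik
  let φ : ℕ → ℕ := fun m => if m < cst bs k then m else m + bs[k].length
  have hφ : ∀ a b, a < b → φ a < φ b := by
    intro a b hab
    simp only [φ]
    split_ifs <;> omega
  have hget : ∀ m, bs.flatten[φ m]? = (bs.take k ++ bs.drop (k+1)).flatten[m]? := by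
    intro m
    conv_lhs => rw [split_at bs k hk, List.flatten_append, List.flatten_cons]
    rw [List.flatten_append]
    simp only [φ]
    split_ifs with hm
    · rw [List.getElem?_append_left hm, List.getElem?_append_left hm]
    · have hm' : (bs.take k).flatten.length ≤ m := not_lt.1 hm
      rw [List.getElem?_append_right (by omega), List.getElem?_append_right (by omega),
        List.getElem?_append_right hm']
      congr 1
      omega
  have e1 : φ p = p := by simp only [φ]; rw [if_pos hpk]
  have e2 : φ (q - bs[k].length) = q := by
    simp only [φ]; rw [if_neg (by omega)]; omega
  obtain ⟨⟨t1, t2, h1, h2, h3⟩, h4, h5⟩ := hrace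
  refine ⟨p, q - bs[k].length, ⟨t1, t2, ?_, ?_, h3⟩, fun hb => ?_, fun hb => ?_⟩
  · rw [← hget, e1, h1]
  · rw [← hget, e2, h2]
  · have := HB_map hnb hV φ hφ (fun m _ => hget m) hb
    rw [e1, e2] at this
    exact h4 this
  · have := HB_map hnb hV φ hφ (fun m _ => hget m) hb
    rw [e1, e2] at this
    exact h5 this

theorem exists_NF (hnb : NoBarriers P) {RS : RSets P} (hC : IsConflictRel P C) {s : GState P} :
    ∀ (n : ℕ) (bs : List (List (GStmt P))), bs.length ≤ n → CP RS s bs → HasRace C bs.flatten →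
    NF RS C s := by
  intro n
  induction n with
  | zero =>
    intro bs hn h hr
    rcases reduce hnb hC h hr with h1 | ⟨bs', _, _, h3⟩
    · exact h1
    · omega
  | succ n ih =>
    intro bs hn h hr
    rcases reduce hnb hC h hr with h1 | ⟨bs', h1, h2, h3⟩
    · exact h1
    · exact ih bs' (by omega) h1 h2

theorem lift_path (hnb : NoBarriers P) {RS : RSets P} (u : RNode P) (l : List (GStmt P))
    (h : ∀ k (hk : k < l.length), SE RS (run u.st (l.take k)) l[k]) :
    ∃ f : ℕ → RNode P, f 0 = u ∧ IsPathFn RS f l ∧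
      ∀ k, k ≤ l.length → (f k).st = run u.st (l.take k) := by
  induction l generalizing u with
  | nil =>
    refine ⟨fun _ => u, rfl, fun k hk => by simp at hk, fun k hk => by simp⟩
  | cons t l ih =>
    have h0 := h 0 (by simp)
    obtain ⟨v, hv⟩ := SE_lift hnb u t h0
    have hst := (redge_SE hv).2
    obtain ⟨f, hf0, hf1, hf2⟩ := ih v (fun k hk => by
      have := h (k+1) (by simpa using hk)
      simpa [hst] using this)
    refine ⟨fun k => Nat.casesOn k u f, rfl, ?_, ?_⟩
    · intro k hk
      cases k with
      | zero => simpa [hf0] using hv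
      | succ k => exact hf1 k (by simpa using hk)
    · intro k hk
      cases k with
      | zero => rfl
      | succ k =>
        have := hf2 k (by simpa using hk)
        simpa [hst] using this

theorem HB_prefix (hnb : NoBarriers P) {s : GState P} {L l l' : List (GStmt P)} (hV : Val s L)
    (h2 : L = l ++ l') {p q : ℕ} (hp : p < l.length) (hq : q < l.length) (hb : HB L p q) :
    HB l p q := by
  have hx := val_noexit hnb hV
  have hget : ∀ m, m < l.length → L[m]? = l[m]? := by
    intro m hm
    rw [h2, List.getElem?_append_left hm]
  have hs : ∀ m r, m < l.length → (stmtIs L m r ↔ stmtIs l m r) := by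
    intro m r hm
    unfold stmtIs
    rw [hget m hm]
  have step : ∀ j k, k < l.length → (IntraThread L j k ∨ RelAcq L j k ∨ BarrierRel L j k) →
      j < l.length ∧ HB l j k := by
    rintro j k hk (⟨h1, h2, h3⟩ | ⟨x, h1, h2, h3, h4⟩ | h1)
    · refine ⟨by omega, HB_intra h1 hk ?_⟩
      unfold tidAt at *
      rw [← hget j (by omega), ← hget k hk, h3]
    · refine ⟨by omega, Relation.TransGen.single (Or.inr (Or.inl ⟨x, h1,
        (hs _ _ (by omega)).1 h2, (hs _ _ hk).1 h3, fun m g1 g2 g3 => h4 m g1 g2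
          ((hs _ _ (by omega)).2 g3)⟩))⟩
    · exact absurd h1 (no_barrierRel hx _ _)
  clear hp
  induction hb with
  | single h1 => exact (step _ _ hq h1).2
  | tail _ h1 ih =>
    have := step _ _ hq h1
    exact (ih this.1).trans this.2

/-- Racy path normal form: if some path from `u0` has a racy execution, then
there is a complete path from `u0` in which some block races with the last
block and no later block is from the same thread. -/
theorem stmt15 (P : Program) (hnb : NoBarriers P) (RS : RSets P)
    (C : GStmt P → GStmt P → Prop) (hC : IsConflictRel P C)
    (u0 : RNode P) (hfin : {v | RReach RS u0 v}.Finite)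
    (h : ∃ l v, RPath RS u0 l v ∧ HasRace C l) :
    ∃ (f : ℕ → RNode P) (ts : List (GStmt P)) (N : ℕ) (c : ℕ → ℕ),
      IsPathFn RS f ts ∧ f 0 = u0 ∧ IsBlockDecomp RS f ts N c ∧
      (∀ j, j < N → BlockComplete RS f ts c j) ∧
      ∃ i, i + 1 < N ∧
        (∃ p q, c i ≤ p ∧ p < c (i+1) ∧ c (N-1) ≤ q ∧ q < c N ∧ Races C ts p q) ∧
        (∀ j, i < j → j < N → tidAt ts (c j) ≠ tidAt ts (c i)) := by
  obtain ⟨l, v, hp, p0, q0, hr⟩ := h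
  have hNF : NF RS C u0.st := by
    obtain ⟨bs, l', h1, h2⟩ := (RPath_CP hnb hfin hp ⟨[], .nil _⟩).1
    refine exists_NF hnb hC bs.length bs le_rfl h1 ⟨p0, q0, ?_⟩
    have hV := CP_val h1
    have hget : ∀ m, m < l.length → bs.flatten[m]? = l[m]? := by
      intro m hm
      rw [h2, List.getElem?_append_left hm]
    obtain ⟨⟨t1, t2, k1, k2, k3⟩, k4, k5⟩ := hr
    have m1 := (List.getElem?_eq_some_iff.1 k1).1
    have m2 := (List.getElem?_eq_some_iff.1 k2).1
    exact ⟨⟨t1, t2, by rw [hget _ m1, k1], by rw [hget _ m2, k2], k3⟩,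
      fun hb => k4 (HB_prefix hnb hV h2 m1 m2 hb), fun hb => k5 (HB_prefix hnb hV h2 m2 m1 hb)⟩
  obtain ⟨bs, h, i, hi, ⟨p, q, h1, h2, h3, h4, h5⟩, h6⟩ := hNF
  obtain ⟨f, hf0, hf1, hf2⟩ := lift_path hnb u0 bs.flatten (RS := RS) (by
    intro m hm
    obtain ⟨j, hj, k, hk, rfl⟩ := find_block bs m hm
    have e := flat_at bs j hj k hk
    rw [List.getElem?_eq_getElem hm] at e
    injection e with e
    rw [e, flat_take bs j hj k hk.le, run_append]
    obtain ⟨_, g, -⟩ := BL_facts (CP_block h j hj)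
    exact (g k hk).2.1)
  have hst : ∀ j (hj : j < bs.length) k, k ≤ bs[j].length →
      (f (cst bs j + k)).st = run (run u0.st (bs.take j).flatten) (bs[j].take k) := by
    intro j hj k hk
    have hle : cst bs j + k ≤ bs.flatten.length := by
      have := cst_mono bs (show j + 1 ≤ bs.length by omega)
      rw [cst_succ bs j hj, cst_last] at this
      omega
    rw [hf2 _ hle, flat_take bs j hj k hk, run_append]
  have hcomp : ∀ j, j < bs.length → BlockComplete RS f bs.flatten (cst bs) j := by
    intro j hj t ht
    obtain ⟨g0, g1, g2⟩ := BL_facts (CP_block h j hj)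
    have e := flat_at bs j hj 0 g0
    rw [Nat.add_zero, ht] at e
    injection e with e
    rw [e, cst_succ bs j hj, hst j hj _ le_rfl, List.take_length]
    exact g2
  refine ⟨f, bs.flatten, bs.length, cst bs, hf1, hf0, ⟨?_, cst_last bs, ?_, ?_, ?_⟩, hcomp,
    i, hi, ⟨p, q, h1, h2, h3, h4, h5⟩, h6⟩
  · simp [cst]
  · intro j hj
    have := (BL_facts (CP_block h j hj)).1
    rw [cst_succ bs j hj]; omega
  · intro j hj m hm1 hm2
    rw [cst_succ bs j hj] at hm2
    obtain ⟨k, rfl⟩ := Nat.exists_eq_add_of_lt hm1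
    have hk : k + 1 < bs[j].length := by omega
    obtain ⟨g0, g1, g2⟩ := BL_facts (CP_block h j hj)
    rw [Nat.add_assoc]
    refine ⟨tid_at h j hj _ hk, _, flat_at bs j hj _ hk, ?_⟩
    rw [hst j hj _ hk.le, (g1 _ hk).1]
    exact (g1 _ hk).2.2 (by omega)
  · rintro j hj hlt ⟨ht, t, hs1, hs2⟩
    obtain ⟨g0, g1, g2⟩ := BL_facts (CP_block h j hj)
    have e := flat_at bs j hj 0 g0
    rw [Nat.add_zero] at e
    refine hcomp j hj _ e ?_
    have : t.1 = bs[j][0].1 := by simpa [tidAt, hs1, e] using ht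
    rw [← this]
    exact hs2


end MC
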